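/- Let F be a field of characteristic ≠ 2, D a central division F-algebra of dimension 16 that is isomorphic to a tensor product of two quaternion F-algebras (a biquaternion division algebra), θ an orthogonal involution on D, and a ∈ D× with θ(a) = a. Let σ be the adjoint involution of the hermitian form ⟨1,−a⟩ on M₂(D), namely σ(X) = G⁻¹·θᵗ(X)·G where θᵗ(X) is obtained from X by applying θ entrywise and transposing, and G = diag(1,−a). If (M₂(D),σ) is totally decomposable, i.e. isomorphic as an F-algebra with involution to a tensor product of three quaternion F-algebras each with an involution of the first kind, then the involutions θ and θ′ := Int(a⁻¹)∘θ (θ′(x) = a⁻¹θ(x)a) are conjugate: there exists u ∈ D× with θ′(x) = u·θ(u⁻¹xu)·u⁻¹ for all x ∈ D. -/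

import Mathlib

open scoped TensorProduct Quaternion Matrix

/-- An involution of the first kind on an `F`-algebra `A`: an `F`-linear anti-automorphism
of order two. -/
def IsInvolution (F A : Type) [CommSemiring F] [Ring A] [Algebra F A]
    (θ : A →ₗ[F] A) : Prop :=
  (∀ x y : A, θ (x * y) = θ y * θ x) ∧ (∀ x : A, θ (θ x) = x)

/-- The space of symmetric elements of a linear map. -/
def symmElements (F A : Type) [CommSemiring F] [AddCommGroup A] [Module F A]
    (θ : A →ₗ[F] A) : Submodule F A :=
  LinearMap.ker (θ - LinearMap.id)

/-- An involution of the first kind on a central simple algebra of degree `n` is orthogonal if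
its space of symmetric elements has dimension `n(n+1)/2`. -/
def IsOrthogonalInvolution (F A : Type) [Field F] [Ring A] [Algebra F A]
    (θ : A →ₗ[F] A) (n : ℕ) : Prop :=
  IsInvolution F A θ ∧ Module.finrank F (symmElements F A θ) = n * (n + 1) / 2

/-- A pair of anticommuting elements with non-zero scalar squares, both `ε`-symmetric. -/
structure QPair (F : Type) {A : Type} [Field F] [Ring A] [Algebra F A]
    (σ : A →ₗ[F] A) (ε : F) (x y : A) : Prop where
  hx : ∃ c : F, c ≠ 0 ∧ x * x = algebraMap F A c
  hy : ∃ c : F, c ≠ 0 ∧ y * y = algebraMap F A c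
  anti : y * x = -(x * y)
  sx : σ x = ε • x
  sy : σ y = ε • y

section Quat
variable {F : Type} [Field F] {a b : F}

lemma quat_sq_pure (w : ℍ[F,a,b]) (hw : w.re = 0) :
    w * w = algebraMap F _ (a * w.imI ^ 2 + b * w.imJ ^ 2 - a * b * w.imK ^ 2) := by
  ext <;> simp [hw, QuaternionAlgebra.algebraMap_eq] <;> ring

lemma quat_re_comm (x y : ℍ[F,a,b]) : (x * y).re = (y * x).re := by
  simp; ring

lemma quat_pure_comm (w : ℍ[F,a,b]) (hw : w.re = 0) (h2 : (2:F) ≠ 0) (ha : a ≠ 0) (hb : b ≠ 0) :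
    ∃ x y z t : ℍ[F,a,b], w = (x * y - y * x) + (z * t - t * z) := by
  refine ⟨⟨0,1,0,0⟩, ⟨0,0,w.imK/2,w.imJ/(2*a)⟩, ⟨0,0,1,0⟩, ⟨0,0,0,-w.imI/(2*b)⟩, ?_⟩
  ext <;> simp [hw] <;> field_simp <;> ring

lemma quat_inv_pure (h2 : (2:F) ≠ 0) (ha : a ≠ 0) (hb : b ≠ 0)
    (σ : ℍ[F,a,b] →ₗ[F] ℍ[F,a,b]) (hσ : IsInvolution F _ σ) (w : ℍ[F,a,b]) (hw : w.re = 0) :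
    (σ w).re = 0 := by
  obtain ⟨x, y, z, t, rfl⟩ := quat_pure_comm w hw h2 ha hb
  simp only [map_add, map_sub, hσ.1, QuaternionAlgebra.re_add, QuaternionAlgebra.re_sub]
  rw [quat_re_comm (σ y), quat_re_comm (σ t)]; ring

lemma quat_split (h2 : (2:F) ≠ 0) (ha : a ≠ 0) (hb : b ≠ 0)
    (σ : ℍ[F,a,b] →ₗ[F] ℍ[F,a,b]) (hσ : IsInvolution F _ σ) (v : ℍ[F,a,b]) (hv : v.re = 0)
    (c : F) (hc : c ≠ 0) (hvc : v * v = algebraMap F _ c) :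
    ∃ (w : ℍ[F,a,b]) (ε d : F), (w = v + σ v ∨ w = v - σ v) ∧ (ε = 1 ∨ ε = -1) ∧ w.re = 0 ∧
      d ≠ 0 ∧ w * w = algebraMap F _ d ∧ σ w = ε • w := by
  have h0 := quat_inv_pure h2 ha hb σ hσ v hv
  have hp : (v + σ v).re = 0 := by simp [hv, h0]
  have hm : (v - σ v).re = 0 := by simp [hv, h0]
  have e1 := quat_sq_pure _ hp
  have e2 := quat_sq_pure _ hm
  set d1 := a * (v + σ v).imI ^ 2 + b * (v + σ v).imJ ^ 2 - a * b * (v + σ v).imK ^ 2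
  set d2 := a * (v - σ v).imI ^ 2 + b * (v - σ v).imJ ^ 2 - a * b * (v - σ v).imK ^ 2
  have hs : σ v * σ v = algebraMap F _ c := by
    rw [← hσ.1, hvc, Algebra.algebraMap_eq_smul_one, map_smul]
    congr 1
    have := hσ.1 1 (σ 1)
    simpa [hσ.2] using this.symm
  have hsum : algebraMap F ℍ[F,a,b] (d1 + d2) = algebraMap F _ (4 * c) := by
    rw [map_add, ← e1, ← e2, map_mul, ← hvc]
    have : (v + σ v) * (v + σ v) + (v - σ v) * (v - σ v) = 2 * (v * v) + 2 * (σ v * σ v) := by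
      noncomm_ring
    rw [this, hs, hvc, map_ofNat]; rw [← add_mul]; norm_num
  have hsum' : d1 + d2 = 4 * c := (algebraMap F ℍ[F,a,b]).injective hsum
  by_cases hd : d1 = 0
  · refine ⟨v - σ v, -1, d2, Or.inr rfl, Or.inr rfl, hm, ?_, e2, ?_⟩
    · intro h
      rw [hd, h] at hsum'
      have : (4:F) ≠ 0 := by
        rw [show (4:F) = 2 * 2 by norm_num]; exact mul_ne_zero h2 h2
      simp_all
    · simp [hσ.2]
  · refine ⟨v + σ v, 1, d1, Or.inl rfl, Or.inl rfl, hp, hd, e1, ?_⟩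
    simp [hσ.2, add_comm]

lemma quat_perp (h2 : (2:F) ≠ 0) (ha : a ≠ 0) (hb : b ≠ 0) (x : ℍ[F,a,b]) (hx : x.re = 0)
    (c : F) (hc : c ≠ 0) (hxc : x * x = algebraMap F _ c) :
    ∃ (v : ℍ[F,a,b]) (d : F), v.re = 0 ∧ d ≠ 0 ∧ v * v = algebraMap F _ d ∧ v * x = -(x * v) := by
  have hc' : c = a * x.imI ^ 2 + b * x.imJ ^ 2 - a * b * x.imK ^ 2 := by
    rw [quat_sq_pure x hx] at hxc
    exact ((algebraMap F ℍ[F,a,b]).injective hxc).symm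
  by_cases h1 : a * c - (a * x.imI) ^ 2 = 0
  · by_cases h3 : b * c - (b * x.imJ) ^ 2 = 0
    · by_cases h4 : -(a*b) * c - (a * b * x.imK) ^ 2 = 0
      · exfalso
        have e1 : c = a * x.imI ^ 2 := by
          apply mul_left_cancel₀ ha; linear_combination h1
        have e2 : c = b * x.imJ ^ 2 := by
          apply mul_left_cancel₀ hb; linear_combination h3
        have e3 : c = - (a * b * x.imK ^ 2) := by
          apply mul_left_cancel₀ (mul_ne_zero ha hb); linear_combination -h4
        have : 2 * c = 0 := by linear_combination -hc' + e1 + e2 + e3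
        exact mul_ne_zero h2 hc this
      · refine ⟨⟨0, (a*b*x.imK) * x.imI, (a*b*x.imK) * x.imJ, c + (a*b*x.imK) * x.imK⟩,
          c * (-(a*b) * c - (a * b * x.imK) ^ 2), rfl, mul_ne_zero hc h4, ?_, ?_⟩
        · rw [quat_sq_pure _ rfl]; congr 1; simp only; rw [hc']; ring
        · ext <;> simp [hx] <;> ((try rw [hc']); ring)
    · refine ⟨⟨0, -(b*x.imJ) * x.imI, c - (b*x.imJ) * x.imJ, -(b*x.imJ) * x.imK⟩,
          c * (b * c - (b * x.imJ) ^ 2), rfl, mul_ne_zero hc h3, ?_, ?_⟩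
      · rw [quat_sq_pure _ rfl]; congr 1; simp only; rw [hc']; ring
      · ext <;> simp [hx] <;> ((try rw [hc']); ring)
  · refine ⟨⟨0, c - (a*x.imI) * x.imI, - (a*x.imI) * x.imJ, -(a*x.imI) * x.imK⟩,
          c * (a * c - (a * x.imI) ^ 2), rfl, mul_ne_zero hc h1, ?_, ?_⟩
    · rw [quat_sq_pure _ rfl]; congr 1; simp only; rw [hc']; ring
    · ext <;> simp [hx] <;> ((try rw [hc']); ring)

lemma quat_pair (h2 : (2:F) ≠ 0) (ha : a ≠ 0) (hb : b ≠ 0)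
    (σ : ℍ[F,a,b] →ₗ[F] ℍ[F,a,b]) (hσ : IsInvolution F _ σ) :
    ∃ (ε : F) (x y : ℍ[F,a,b]), (ε = 1 ∨ ε = -1) ∧ QPair F σ ε x y := by
  obtain ⟨x, s, c, -, hs, hx, hc, hxc, hsx⟩ := quat_split h2 ha hb σ hσ ⟨0,1,0,0⟩ rfl a ha
    (by ext <;> simp [QuaternionAlgebra.algebraMap_eq])
  obtain ⟨v, d', hv, hd', hvd, hvx⟩ := quat_perp h2 ha hb x hx c hc hxc
  obtain ⟨y, t, d, hyv, ht, hy, hd, hyd, hty⟩ := quat_split h2 ha hb σ hσ v hv d' hd' hvd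
  have hss : s * s = 1 := by rcases hs with rfl | rfl <;> ring
  have hs0 : s ≠ 0 := by rintro rfl; simp at hss
  have hvx' : σ v * x = -(x * σ v) := by
    have := congrArg σ hvx
    rw [map_neg, hσ.1, hσ.1, hsx, smul_mul_assoc, mul_smul_comm, ← smul_neg] at this
    have := smul_right_injective _ hs0 this
    rw [this, neg_neg]
  have hyx : y * x = -(x * y) := by
    rcases hyv with rfl | rfl
    · rw [add_mul, mul_add, hvx, hvx']; abel
    · rw [sub_mul, mul_sub, hvx, hvx']; abel
  have hzz : (x * y) * (x * y) = algebraMap F _ (-(c * d)) := by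
    calc (x * y) * (x * y) = x * (y * x) * y := by noncomm_ring
      _ = -((x * x) * (y * y)) := by rw [hyx]; noncomm_ring
      _ = _ := by rw [hxc, hyd, map_neg, map_mul]
  have hz : σ (x * y) = (-(s * t)) • (x * y) := by
    rw [hσ.1, hsx, hty, smul_mul_assoc, mul_smul_comm, hyx, smul_smul, smul_neg, neg_smul, mul_comm]
  have hcd : -(c * d) ≠ 0 := neg_ne_zero.mpr (mul_ne_zero hc hd)
  by_cases hst : s = t
  · subst hst
    exact ⟨s, x, y, hs, ⟨c, hc, hxc⟩, ⟨d, hd, hyd⟩, hyx, hsx, hty⟩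
  · rcases hs with rfl | rfl <;> rcases ht with rfl | rfl
    · simp at hst
    · refine ⟨1, x, x * y, Or.inl rfl, ⟨c, hc, hxc⟩, ⟨_, hcd, hzz⟩, ?_, hsx, by simpa using hz⟩
      rw [mul_assoc, hyx, mul_neg]
    · refine ⟨1, y, x * y, Or.inl rfl, ⟨d, hd, hyd⟩, ⟨_, hcd, hzz⟩, ?_, hty, by simpa using hz⟩
      rw [← mul_assoc, hyx, neg_mul, neg_neg]
    · simp at hst

lemma quat_trace (h2 : (2:F) ≠ 0)
    (σ : ℍ[F,a,b] →ₗ[F] ℍ[F,a,b]) (hσ : IsInvolution F _ σ) (ε : F) (hε : ε = 1 ∨ ε = -1)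
    (x y : ℍ[F,a,b]) (h : QPair F σ ε x y) : LinearMap.trace F _ σ = 2 * ε := by
  obtain ⟨c, hc, hxc⟩ := h.hx
  obtain ⟨d, hd, hyd⟩ := h.hy
  have hyx := h.anti
  have hσ1 : σ 1 = 1 := by
    have := hσ.1 1 (σ 1)
    simpa [hσ.2] using this.symm
  have hεε : ε * ε = 1 := by rcases hε with rfl | rfl <;> ring
  have hz : σ (x * y) = (-1 : F) • (x * y) := by
    rw [hσ.1, h.sx, h.sy, smul_mul_assoc, mul_smul_comm, hyx, smul_smul, hεε]; simp
  have hx0 : x ≠ 0 := by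
    rintro rfl; exact hc ((algebraMap F ℍ[F,a,b]).injective (by simpa using hxc.symm))
  have hy0 : y ≠ 0 := by
    rintro rfl; exact hd ((algebraMap F ℍ[F,a,b]).injective (by simpa using hyd.symm))
  have hz0 : x * y ≠ 0 := by
    intro h0
    have : x * (x * y) = 0 := by rw [h0, mul_zero]
    rw [← mul_assoc, hxc, ← Algebra.smul_def] at this
    exact hy0 ((smul_eq_zero.mp this).resolve_left hc)
  have hli : LinearIndependent F ![(1:ℍ[F,a,b]), x, y, x * y] := by
    rw [Fintype.linearIndependent_iff]
    intro g hg
    simp only [Fin.sum_univ_four, Matrix.cons_val] at hg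
    set α := g 0; set β := g 1; set γ := g 2; set δ := g 3
    -- conjugation by x
    have k1 : x * (α • 1 + β • x + γ • y + δ • (x * y)) + (α • 1 + β • x + γ • y + δ • (x * y)) * x
        = (2 : F) • (c • (β • 1) + α • x) := by
      simp only [mul_add, add_mul, mul_smul_comm, smul_mul_assoc, mul_one, one_mul, mul_assoc, hyx,
        mul_neg, hxc, Algebra.algebraMap_eq_smul_one]
      module
    have k2 : x * (α • 1 + β • x + γ • y + δ • (x * y)) - (α • 1 + β • x + γ • y + δ • (x * y)) * x
        = (2 : F) • (γ • (x * y) + c • δ • y) := by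
      have : x * (x * y) = c • y := by rw [← mul_assoc, hxc, Algebra.smul_def]
      simp only [mul_add, add_mul, mul_smul_comm, smul_mul_assoc, mul_one, one_mul, mul_assoc, hyx,
        mul_neg, hxc, Algebra.algebraMap_eq_smul_one, this]
      module
    rw [hg] at k1 k2
    simp only [mul_zero, zero_mul, add_zero, sub_zero] at k1 k2
    have k1' := (smul_eq_zero.mp k1.symm).resolve_left h2
    have k2' := (smul_eq_zero.mp k2.symm).resolve_left h2
    have m1 : y * (c • (β • 1) + α • x) + (c • (β • 1) + α • x) * y = (2 * c * β) • y := by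
      simp only [mul_add, add_mul, mul_smul_comm, smul_mul_assoc, mul_one, one_mul, hyx]
      module
    have m2 : y * (γ • (x * y) + c • δ • y) + (γ • (x * y) + c • δ • y) * y = (2 * c * δ) • (y * y) := by
      simp only [mul_add, add_mul, mul_smul_comm, smul_mul_assoc, ← mul_assoc, hyx, neg_mul]
      module
    rw [k1', mul_zero, zero_mul, add_zero] at m1
    rw [k2', mul_zero, zero_mul, add_zero, hyd, Algebra.algebraMap_eq_smul_one, smul_smul] at m2
    have hβ : β = 0 := by
      have := (smul_eq_zero.mp m1.symm).resolve_right hy0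
      simpa [h2, hc] using this
    have hδ : δ = 0 := by
      have := (smul_eq_zero.mp m2.symm).resolve_right one_ne_zero
      simpa [h2, hc, hd] using this
    rw [hβ, zero_smul, smul_zero, zero_add] at k1'
    rw [hδ, zero_smul, smul_zero, add_zero] at k2'
    have hα := (smul_eq_zero.mp k1').resolve_right hx0
    have hγ := (smul_eq_zero.mp k2').resolve_right hz0
    intro i; fin_cases i <;> assumption
  let B := basisOfLinearIndependentOfCardEqFinrank hli
    (by simp [QuaternionAlgebra.finrank_eq_four])
  have hB : ∀ i, B i = ![(1:ℍ[F,a,b]), x, y, x * y] i := fun i => by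
    simp [B]
  have hσB : ∀ i, σ (B i) = (![1, ε, ε, -1] i) • B i := by
    intro i; rw [hB]
    fin_cases i
    · simp [hσ1]
    · simpa using h.sx
    · simpa using h.sy
    · simpa using hz
  rw [LinearMap.trace_eq_matrix_trace F B]
  simp only [Matrix.trace, Matrix.diag, LinearMap.toMatrix_apply, hσB, map_smul, Finsupp.smul_apply,
    Module.Basis.repr_self, Finsupp.single_eq_same, smul_eq_mul, mul_one]
  simp only [Fin.sum_univ_four, Matrix.cons_val]; ring
end Quat

section Seven
variable {F A : Type} [Field F] [Ring A] [Algebra F A]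

/-- Pairwise commutation of two pairs. -/
structure CPair (x y z t : A) : Prop where
  xz : Commute x z
  xt : Commute x t
  yz : Commute y z
  yt : Commute y t

lemma CPair.symm {x y z t : A} (h : CPair x y z t) : CPair z t x y :=
  ⟨h.xz.symm, h.yz.symm, h.xt.symm, h.yt.symm⟩

lemma scalar_sq_mul {x y : A} (h : Commute x y)
    (hx : ∃ c : F, c ≠ 0 ∧ x * x = algebraMap F A c)
    (hy : ∃ c : F, c ≠ 0 ∧ y * y = algebraMap F A c) :
    ∃ c : F, c ≠ 0 ∧ (x * y) * (x * y) = algebraMap F A c := by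
  obtain ⟨c, hc, hxc⟩ := hx
  obtain ⟨d, hd, hyd⟩ := hy
  refine ⟨c * d, mul_ne_zero hc hd, ?_⟩
  rw [h.symm.mul_mul_mul_comm, hxc, hyd, map_mul]

lemma scalar_sq_mul_anti {x y : A} (h : y * x = -(x * y))
    (hx : ∃ c : F, c ≠ 0 ∧ x * x = algebraMap F A c)
    (hy : ∃ c : F, c ≠ 0 ∧ y * y = algebraMap F A c) :
    ∃ c : F, c ≠ 0 ∧ (x * y) * (x * y) = algebraMap F A c := by
  obtain ⟨c, hc, hxc⟩ := hx
  obtain ⟨d, hd, hyd⟩ := hy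
  refine ⟨-(c * d), neg_ne_zero.mpr (mul_ne_zero hc hd), ?_⟩
  calc (x * y) * (x * y) = x * (y * x) * y := by noncomm_ring
      _ = -((x * x) * (y * y)) := by rw [h]; noncomm_ring
      _ = _ := by rw [hxc, hyd, map_neg, map_mul]

lemma anti_mul_left {x y : A} (h : y * x = -(x * y)) : (x * y) * x = -(x * (x * y)) := by
  rw [mul_assoc, h, mul_neg]

lemma anti_mul_right {x y : A} (h : y * x = -(x * y)) : (x * y) * y = -(y * (x * y)) := by
  rw [← mul_assoc y, h, neg_mul, neg_neg]

/-- Products of an anticommuting and a commuting factor. -/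
lemma anti_of {p q x y : A} (hpq : q * p = -(p * q)) (hxy : Commute x y) (hpy : Commute p y)
    (hqx : Commute q x) : (q * y) * (p * x) = -((p * x) * (q * y)) := by
  rw [hpy.symm.mul_mul_mul_comm, hqx.symm.mul_mul_mul_comm, hpq, hxy.eq, neg_mul]

lemma anti_of' {p q x y : A} (hxy : y * x = -(x * y)) (hpq : Commute p q) (hpy : Commute p y)
    (hqx : Commute q x) : (q * y) * (p * x) = -((p * x) * (q * y)) := by
  rw [hpy.symm.mul_mul_mul_comm, hqx.symm.mul_mul_mul_comm, hxy, hpq.eq, mul_neg]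

/-- The conclusion: seven pairwise anticommuting skew elements with non-zero scalar squares. -/
def HasSeven (F : Type) {A : Type} [Field F] [Ring A] [Algebra F A] (σ : A →ₗ[F] A) : Prop :=
  ∃ E : (Fin 3 ⊕ Fin 3) ⊕ Unit → A,
    (∀ k, ∃ c : F, c ≠ 0 ∧ E k * E k = algebraMap F A c) ∧
    (∀ k l, k ≠ l → E l * E k = -(E k * E l)) ∧ (∀ k, σ (E k) = - E k)

lemma pure3_sq {σ : A →ₗ[F] A} {ε : F} {x y : A} (h : QPair F σ ε x y) (k : Fin 3) :
    ∃ c : F, c ≠ 0 ∧ ![x, y, x * y] k * ![x, y, x * y] k = algebraMap F A c := by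
  fin_cases k
  · exact h.hx
  · exact h.hy
  · exact scalar_sq_mul_anti h.anti h.hx h.hy

lemma pure3_anti {σ : A →ₗ[F] A} {ε : F} {x y : A} (h : QPair F σ ε x y) (k l : Fin 3)
    (hkl : k ≠ l) : ![x, y, x * y] l * ![x, y, x * y] k =
      -(![x, y, x * y] k * ![x, y, x * y] l) := by
  have h1 := h.anti
  have h2 := anti_mul_left h1
  have h3 := anti_mul_right h1
  fin_cases k <;> fin_cases l <;> first | exact absurd rfl hkl | skip
  · exact h1
  · exact h2
  · exact (neg_eq_iff_eq_neg.mpr h1).symm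
  · exact h3
  · exact (neg_eq_iff_eq_neg.mpr h2).symm
  · exact (neg_eq_iff_eq_neg.mpr h3).symm

lemma pure3_commute {x y z : A} (hx : Commute x z) (hy : Commute y z) (k : Fin 3) :
    Commute (![x, y, x * y] k) z := by
  fin_cases k
  · exact hx
  · exact hy
  · exact hx.mul_left hy

lemma pure3_skew {σ : A →ₗ[F] A} (hσ : ∀ x y : A, σ (x * y) = σ y * σ x) {x y : A}
    (h : QPair F σ (-1) x y) (k : Fin 3) : σ (![x, y, x * y] k) = - ![x, y, x * y] k := by
  fin_cases k
  · simpa using h.sx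
  · simpa using h.sy
  · simp [hσ, h.sx, h.sy, h.anti]

lemma hasSeven_of_OSS (σ : A →ₗ[F] A) (hσ : ∀ x y : A, σ (x * y) = σ y * σ x)
    {x₁ y₁ x₂ y₂ x₃ y₃ : A} (h₁ : QPair F σ 1 x₁ y₁) (h₂ : QPair F σ (-1) x₂ y₂)
    (h₃ : QPair F σ (-1) x₃ y₃) (h₁₂ : CPair x₁ y₁ x₂ y₂) (h₁₃ : CPair x₁ y₁ x₃ y₃)
    (h₂₃ : CPair x₂ y₂ x₃ y₃) : HasSeven F σ := by
  have sx₁ : σ x₁ = x₁ := by simpa using h₁.sx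
  have sy₁ : σ y₁ = y₁ := by simpa using h₁.sy
  set p : Fin 3 → A := ![x₂, y₂, x₂ * y₂] with hp
  set q : Fin 3 → A := ![x₃, y₃, x₃ * y₃] with hq
  have px : ∀ k, Commute (p k) x₁ := pure3_commute h₁₂.xz.symm h₁₂.xt.symm
  have py : ∀ k, Commute (p k) y₁ := pure3_commute h₁₂.yz.symm h₁₂.yt.symm
  have qx : ∀ k, Commute (q k) x₁ := pure3_commute h₁₃.xz.symm h₁₃.xt.symm
  have qy : ∀ k, Commute (q k) y₁ := pure3_commute h₁₃.yz.symm h₁₃.yt.symm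
  have pq : ∀ k l, Commute (p k) (q l) := fun k l =>
    pure3_commute (pure3_commute h₂₃.xz.symm h₂₃.xt.symm l).symm
      (pure3_commute h₂₃.yz.symm h₂₃.yt.symm l).symm k
  have a1 : ∀ k l, (q l * y₁) * (p k * x₁) = -((p k * x₁) * (q l * y₁)) := fun k l =>
    anti_of' h₁.anti (pq k l) (py k) (qx l)
  have a2 : ∀ k, (x₁ * y₁) * (p k * x₁) = -((p k * x₁) * (x₁ * y₁)) := fun k => by
    have := anti_of' (p := p k) (q := 1) (anti_mul_left h₁.anti) (Commute.one_right _)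
      ((px k).mul_right (py k)) (Commute.one_left _)
    simpa using this
  have a3 : ∀ k, (x₁ * y₁) * (q k * y₁) = -((q k * y₁) * (x₁ * y₁)) := fun k => by
    have := anti_of' (p := q k) (q := 1) (anti_mul_right h₁.anti) (Commute.one_right _)
      ((qx k).mul_right (qy k)) (Commute.one_left _)
    simpa using this
  refine ⟨Sum.elim (Sum.elim (fun k => p k * x₁) (fun k => q k * y₁)) (fun _ => x₁ * y₁),
    ?_, ?_, ?_⟩
  · rintro ((k | k) | k)
    · exact scalar_sq_mul (px k) (pure3_sq h₂ k) h₁.hx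
    · exact scalar_sq_mul (qy k) (pure3_sq h₃ k) h₁.hy
    · exact scalar_sq_mul_anti h₁.anti h₁.hx h₁.hy
  · rintro ((k | k) | k) ((l | l) | l) hkl
    · exact anti_of (pure3_anti h₂ k l (by rintro rfl; exact hkl rfl)) (Commute.refl _) (px k) (px l)
    · exact a1 k l
    · exact a2 k
    · exact (neg_eq_iff_eq_neg.mpr (a1 l k)).symm
    · exact anti_of (pure3_anti h₃ k l (by rintro rfl; exact hkl rfl)) (Commute.refl _) (qy k) (qy l)
    · exact a3 k
    · exact (neg_eq_iff_eq_neg.mpr (a2 l)).symm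
    · exact (neg_eq_iff_eq_neg.mpr (a3 l)).symm
    · exact absurd rfl hkl
  · rintro ((k | k) | k)
    · change σ (p k * x₁) = -(p k * x₁)
      rw [hσ, sx₁, pure3_skew hσ h₂ k, mul_neg]; rw [← hp, (px k).eq]
    · change σ (q k * y₁) = -(q k * y₁)
      rw [hσ, sy₁, pure3_skew hσ h₃ k, mul_neg]; rw [← hq, (qy k).eq]
    · change σ (x₁ * y₁) = -(x₁ * y₁)
      rw [hσ, sx₁, sy₁, h₁.anti]

lemma hasSeven_of_OOO (σ : A →ₗ[F] A) (hσ : ∀ x y : A, σ (x * y) = σ y * σ x)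
    {x₁ y₁ x₂ y₂ x₃ y₃ : A} (h₁ : QPair F σ 1 x₁ y₁) (h₂ : QPair F σ 1 x₂ y₂)
    (h₃ : QPair F σ 1 x₃ y₃) (h₁₂ : CPair x₁ y₁ x₂ y₂) (h₁₃ : CPair x₁ y₁ x₃ y₃)
    (h₂₃ : CPair x₂ y₂ x₃ y₃) : HasSeven F σ := by
  have sx₁ : σ x₁ = x₁ := by simpa using h₁.sx
  have sy₁ : σ y₁ = y₁ := by simpa using h₁.sy
  have sx₂ : σ x₂ = x₂ := by simpa using h₂.sx
  have sy₂ : σ y₂ = y₂ := by simpa using h₂.sy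
  have z₁ : σ (x₁ * y₁) = -(x₁ * y₁) := by rw [hσ, sx₁, sy₁, h₁.anti]
  have z₂ : σ (x₂ * y₂) = -(x₂ * y₂) := by rw [hσ, sx₂, sy₂, h₂.anti]
  have c12 : Commute x₁ (x₂ * y₂) := h₁₂.xz.mul_right h₁₂.xt
  have d12 : Commute y₁ (x₂ * y₂) := h₁₂.yz.mul_right h₁₂.yt
  have c21 : Commute x₂ (x₁ * y₁) := h₁₂.symm.xz.mul_right h₁₂.symm.xt
  have d21 : Commute y₂ (x₁ * y₁) := h₁₂.symm.yz.mul_right h₁₂.symm.yt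
  have zz : Commute (x₁ * y₁) (x₂ * y₂) := c12.mul_left d12
  have P : QPair F σ (-1) (x₁ * y₁) (x₁ * (x₂ * y₂)) := by
    refine ⟨scalar_sq_mul_anti h₁.anti h₁.hx h₁.hy,
      scalar_sq_mul c12 h₁.hx (scalar_sq_mul_anti h₂.anti h₂.hx h₂.hy), ?_, ?_, ?_⟩
    · have := anti_of (p := x₁ * y₁) (q := x₁) (x := 1) (y := x₂ * y₂)
        (neg_eq_iff_eq_neg.mpr (anti_mul_left h₁.anti)).symm (Commute.one_left _) zz
        (Commute.one_right _)
      simpa using this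
    · simpa using z₁
    · rw [hσ, sx₁, z₂, neg_mul, c12.eq]; simp
  have Q : QPair F σ (-1) (x₂ * y₂) (x₂ * (x₁ * y₁)) := by
    refine ⟨scalar_sq_mul_anti h₂.anti h₂.hx h₂.hy,
      scalar_sq_mul c21 h₂.hx (scalar_sq_mul_anti h₁.anti h₁.hx h₁.hy), ?_, ?_, ?_⟩
    · have := anti_of (p := x₂ * y₂) (q := x₂) (x := 1) (y := x₁ * y₁)
        (neg_eq_iff_eq_neg.mpr (anti_mul_left h₂.anti)).symm (Commute.one_left _) zz.symm
        (Commute.one_right _)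
      simpa using this
    · simpa using z₂
    · rw [hσ, sx₂, z₁, neg_mul, c21.eq]; simp
  have hx13 : Commute (x₁ * y₁) x₃ := h₁₃.xz.mul_left h₁₃.yz
  have hy13 : Commute (x₁ * y₁) y₃ := h₁₃.xt.mul_left h₁₃.yt
  have hx23 : Commute (x₂ * y₂) x₃ := h₂₃.xz.mul_left h₂₃.yz
  have hy23 : Commute (x₂ * y₂) y₃ := h₂₃.xt.mul_left h₂₃.yt
  refine hasSeven_of_OSS σ hσ h₃ P Q ?_ ?_ ?_
  · exact CPair.symm ⟨hx13, hy13, h₁₃.xz.mul_left hx23, h₁₃.xt.mul_left hy23⟩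
  · exact CPair.symm ⟨hx23, hy23, h₂₃.xz.mul_left hx13, h₂₃.xt.mul_left hy13⟩
  · refine ⟨zz, c21.symm.mul_right (Commute.refl _), c12.mul_left (Commute.refl _), ?_⟩
    change (x₁ * (x₂ * y₂)) * (x₂ * (x₁ * y₁)) = (x₂ * (x₁ * y₁)) * (x₁ * (x₂ * y₂))
    have e1 := anti_mul_left h₁.anti
    have e2 := anti_mul_left h₂.anti
    have l : (x₁ * (x₂ * y₂)) * (x₂ * (x₁ * y₁)) = (x₁ * (x₁ * y₁)) * ((x₂ * y₂) * x₂) := by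
      rw [c21.eq, zz.symm.mul_mul_mul_comm]
    have r : (x₂ * (x₁ * y₁)) * (x₁ * (x₂ * y₂)) = ((x₁ * y₁) * x₁) * (x₂ * (x₂ * y₂)) := by
      rw [c21.eq, h₁₂.symm.xz.mul_mul_mul_comm]
    rw [l, r, e1, e2, mul_neg, neg_mul]

lemma hasSeven_of (h2 : (2:F) ≠ 0) (σ : A →ₗ[F] A) (hσ : ∀ x y : A, σ (x * y) = σ y * σ x)
    {x₁ y₁ x₂ y₂ x₃ y₃ : A} {ε₁ ε₂ ε₃ : F} (he₁ : ε₁ = 1 ∨ ε₁ = -1) (he₂ : ε₂ = 1 ∨ ε₂ = -1)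
    (he₃ : ε₃ = 1 ∨ ε₃ = -1) (he : ε₁ * ε₂ * ε₃ = 1)
    (h₁ : QPair F σ ε₁ x₁ y₁) (h₂ : QPair F σ ε₂ x₂ y₂)
    (h₃ : QPair F σ ε₃ x₃ y₃) (h₁₂ : CPair x₁ y₁ x₂ y₂) (h₁₃ : CPair x₁ y₁ x₃ y₃)
    (h₂₃ : CPair x₂ y₂ x₃ y₃) : HasSeven F σ := by
  have hn : (-1 : F) ≠ 1 := fun h => h2 (by linear_combination -h)
  rcases he₁ with rfl | rfl <;> rcases he₂ with rfl | rfl <;> rcases he₃ with rfl | rfl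
  · exact hasSeven_of_OOO σ hσ h₁ h₂ h₃ h₁₂ h₁₃ h₂₃
  · exact absurd (by simpa using he) hn
  · exact absurd (by simpa using he) hn
  · exact hasSeven_of_OSS σ hσ h₁ h₂ h₃ h₁₂ h₁₃ h₂₃
  · exact absurd (by simpa using he) hn
  · exact hasSeven_of_OSS σ hσ h₂ h₁ h₃ h₁₂.symm h₂₃ h₁₃
  · exact hasSeven_of_OSS σ hσ h₃ h₁ h₂ h₁₃.symm h₂₃.symm h₁₂
  · exact absurd (by simpa using he) hn

end Seven

section Core
variable {F D : Type} [Field F] [DivisionRing D] [Algebra F D]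

/-- The adjoint involution of `⟨1,-a⟩`, as a linear map. -/
def sigmaMap (θ : D →ₗ[F] D) (a : D) :
    Matrix (Fin 2) (Fin 2) D →ₗ[F] Matrix (Fin 2) (Fin 2) D where
  toFun X := Matrix.diagonal ![1, -a⁻¹] * (X.map θ)ᵀ * Matrix.diagonal ![1, -a]
  map_add' X Y := by
    rw [Matrix.map_add θ (map_add θ), Matrix.transpose_add, mul_add, add_mul]
  map_smul' c X := by
    rw [Matrix.map_smul θ c (fun x => map_smul θ c x), Matrix.transpose_smul, mul_smul_comm,
      smul_mul_assoc, RingHom.id_apply]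

lemma sigmaMap_apply (θ : D →ₗ[F] D) (a : D) (X : Matrix (Fin 2) (Fin 2) D) (i j : Fin 2) :
    sigmaMap θ a X i j = ![1, -a⁻¹] i * θ (X j i) * ![1, -a] j := by
  change (Matrix.diagonal ![1, -a⁻¹] * (X.map θ)ᵀ * Matrix.diagonal ![1, -a]) i j = _
  rw [Matrix.mul_diagonal, Matrix.diagonal_mul]; rfl

/-- The twisted involution `Int(a⁻¹) ∘ θ`. -/
def thetaP (θ : D →ₗ[F] D) (a : D) : D →ₗ[F] D :=
  LinearMap.mulLeft F a⁻¹ ∘ₗ θ ∘ₗ LinearMap.mulLeft F a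

lemma thetaP_apply (θ : D →ₗ[F] D) (hθ : IsInvolution F D θ) (a : D) (ha : θ a = a) (x : D) :
    thetaP θ a x = a⁻¹ * θ x * a := by
  simp [thetaP, hθ.1, ha, mul_assoc]

/-- The space of skew elements. -/
def skewElements (θ : D →ₗ[F] D) : Submodule F D := LinearMap.ker (θ + LinearMap.id)

lemma mem_skew (θ : D →ₗ[F] D) (x : D) : x ∈ skewElements θ ↔ θ x = -x := by
  simp [skewElements, add_eq_zero_iff_eq_neg]

lemma trace_theta (h2 : (2:F) ≠ 0) [FiniteDimensional F D] (θ : D →ₗ[F] D)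
    (hθ : ∀ x, θ (θ x) = x) :
    LinearMap.trace F D θ = 2 * (Module.finrank F (symmElements F D θ) : F)
      - (Module.finrank F D : F) := by
  have hp : LinearMap.IsProj (symmElements F D θ) ((2:F)⁻¹ • (θ + LinearMap.id)) := by
    constructor
    · intro x
      simp [symmElements, hθ, sub_eq_zero, add_comm]
    · intro x hx
      have : θ x = x := by simpa [symmElements, sub_eq_zero] using hx
      change (2:F)⁻¹ • (θ x + x) = x
      rw [this, ← two_smul F x, smul_smul, inv_mul_cancel₀ h2, one_smul]
  have := hp.trace
  rw [map_smul, map_add, LinearMap.trace_id, smul_eq_mul] at this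
  rw [← this]; field_simp; ring

lemma finrank_skew (h2 : (2:F) ≠ 0) [FiniteDimensional F D] (θ : D →ₗ[F] D)
    (hθ : ∀ x, θ (θ x) = x) :
    Module.finrank F (skewElements θ) + Module.finrank F (symmElements F D θ)
      = Module.finrank F D := by
  apply Submodule.finrank_add_eq_of_isCompl
  constructor
  · rw [Submodule.disjoint_def]
    intro x hx hy
    rw [mem_skew] at hx
    have hy : θ x = x := by simpa [symmElements, sub_eq_zero] using hy
    have : (2:F) • x = 0 := by
      rw [two_smul]; nth_rw 1 [← hy]; rw [hx, neg_add_cancel]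
    exact (smul_eq_zero.mp this).resolve_left h2
  · rw [codisjoint_iff, eq_top_iff]
    intro x _
    rw [Submodule.mem_sup]
    refine ⟨(2:F)⁻¹ • (x - θ x), ?_, (2:F)⁻¹ • (x + θ x), ?_, ?_⟩
    · rw [mem_skew]; simp [hθ, ← smul_neg]
    · simp [symmElements, hθ, sub_eq_zero, add_comm]
    · rw [← smul_add, sub_add_add_cancel, ← two_smul F x, smul_smul, inv_mul_cancel₀ h2, one_smul]

lemma finrank_skewP (θ : D →ₗ[F] D) (a : D) (ha : a ≠ 0) :
    Module.finrank F (skewElements (thetaP θ a)) = Module.finrank F (skewElements θ) := by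
  let L : D ≃ₗ[F] D := LinearEquiv.ofLinearMap (LinearMap.mulLeft F a) (LinearMap.mulLeft F a⁻¹)
    (by ext x; simp [ha]) (by ext x; simp [ha])
  have : skewElements (thetaP θ a) = (skewElements θ).comap (L : D →ₗ[F] D) := by
    ext x
    rw [mem_skew, Submodule.mem_comap, mem_skew]
    change a⁻¹ * θ (a * x) = -x ↔ θ (a * x) = -(a * x)
    rw [inv_mul_eq_iff_eq_mul₀ ha, mul_neg]
  rw [this]
  exact (L.submoduleMap _).finrank_eq.trans (by
    rw [Submodule.map_comap_eq_of_surjective L.surjective])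

lemma trace_thetaP [FiniteDimensional F D] (θ : D →ₗ[F] D) (a : D) (ha : a ≠ 0) :
    LinearMap.trace F D (thetaP θ a) = LinearMap.trace F D θ := by
  unfold thetaP
  rw [LinearMap.trace_comp_comm', LinearMap.comp_assoc]
  congr 1
  ext x; simp [ha]

lemma trace_sigmaMap [FiniteDimensional F D] (θ : D →ₗ[F] D) (hθ : IsInvolution F D θ) (a : D)
    (ha : a ≠ 0) (hs : θ a = a) :
    LinearMap.trace F _ (sigmaMap θ a) = 2 * LinearMap.trace F D θ := by
  let ι : Fin 2 → Fin 2 → D →ₗ[F] Matrix (Fin 2) (Fin 2) D := fun i j =>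
    Matrix.singleLinearMap F i j
  let π : Fin 2 → Fin 2 → Matrix (Fin 2) (Fin 2) D →ₗ[F] D := fun i j =>
    Matrix.entryLinearMap F D i j
  have hsum : sigmaMap θ a = ∑ i, ∑ j, (sigmaMap θ a ∘ₗ ι i j) ∘ₗ π i j := by
    apply LinearMap.ext
    intro X
    conv_lhs => rw [Matrix.matrix_eq_sum_single X]
    simp [ι, π, LinearMap.sum_apply, map_sum]
  have htr : ∀ i j, LinearMap.trace F _ ((sigmaMap θ a ∘ₗ ι i j) ∘ₗ π i j)
      = LinearMap.trace F D (π i j ∘ₗ sigmaMap θ a ∘ₗ ι i j) := fun i j =>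
    LinearMap.trace_comp_comm' _ _
  have e00 : π 0 0 ∘ₗ sigmaMap θ a ∘ₗ ι 0 0 = θ := by
    ext x; simp [π, ι, sigmaMap_apply]
  have e01 : π 0 1 ∘ₗ sigmaMap θ a ∘ₗ ι 0 1 = 0 := by
    ext x; simp [π, ι, sigmaMap_apply, Matrix.single_apply]
  have e10 : π 1 0 ∘ₗ sigmaMap θ a ∘ₗ ι 1 0 = 0 := by
    ext x; simp [π, ι, sigmaMap_apply, Matrix.single_apply]
  have e11 : π 1 1 ∘ₗ sigmaMap θ a ∘ₗ ι 1 1 = thetaP θ a := by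
    ext x; rw [thetaP_apply θ hθ a hs]; simp [π, ι, sigmaMap_apply]
  rw [hsum]
  simp only [Fin.sum_univ_two, map_add, htr, e00, e01, e10, e11, map_zero,
    trace_thetaP θ a ha]
  ring

/-- A `θ`-invariant trace form. -/
lemma exists_trace (h2 : (2:F) ≠ 0) [FiniteDimensional F D] (hdim : Module.finrank F D = 16)
    (θ : D →ₗ[F] D) (hθ : IsInvolution F D θ) :
    ∃ τ : D →ₗ[F] F, (∀ x y, τ (x * y) = τ (y * x)) ∧ τ 1 ≠ 0 ∧ ∀ x, τ (θ x) = τ x := by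
  let t : D →ₗ[F] F := LinearMap.trace F D ∘ₗ (Algebra.lmul F D).toLinearMap
  have ht : ∀ x y, t (x * y) = t (y * x) := fun x y => by
    simp only [t, LinearMap.comp_apply, AlgHom.toLinearMap_apply, map_mul]
    exact LinearMap.trace_mul_comm _ _ _
  have h1 : t 1 = 16 := by
    simp only [t, LinearMap.comp_apply, AlgHom.toLinearMap_apply, map_one]
    rw [LinearMap.trace_one, hdim]; norm_num
  have hθ1 : θ 1 = 1 := by
    have := hθ.1 1 (θ 1)
    simpa [hθ.2] using this.symm
  refine ⟨t + t ∘ₗ θ, ?_, ?_, ?_⟩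
  · intro x y
    simp only [LinearMap.add_apply, LinearMap.comp_apply, hθ.1]
    rw [ht x y, ht (θ y)]
  · simp only [LinearMap.add_apply, LinearMap.comp_apply, hθ1, h1]
    rw [show (16:F) + 16 = 2 ^ 5 by norm_num]
    exact pow_ne_zero _ h2
  · intro x
    simp only [LinearMap.add_apply, LinearMap.comp_apply, hθ.2]; ring

lemma skew_nondeg (h2 : (2:F) ≠ 0) (θ : D →ₗ[F] D) (hm : ∀ x y : D, θ (x * y) = θ y * θ x)
    (hi : ∀ x, θ (θ x) = x)
    (τ : D →ₗ[F] F) (hτ : ∀ x y, τ (x * y) = τ (y * x)) (hτ1 : τ 1 ≠ 0)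
    (hτθ : ∀ x, τ (θ x) = τ x) (p : D) (hp : θ p = -p)
    (h : ∀ q, θ q = -q → τ (p * q) = 0) : p = 0 := by
  by_contra hp0
  have key : ∀ y, τ (p * y) = 0 := by
    intro y
    have k1 := h (y - θ y) (by simp [hi])
    have k2 : τ (p * θ y) = - τ (p * y) := by
      rw [← hτθ, hm, hi, hp, mul_neg, map_neg, hτ]
    rw [mul_sub, map_sub, k2] at k1
    have : 2 * τ (p * y) = 0 := by linear_combination k1
    exact (mul_eq_zero.mp this).resolve_left h2
  apply hτ1
  rw [← mul_inv_cancel₀ hp0]; exact key _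

theorem core (h2 : (2:F) ≠ 0) [FiniteDimensional F D] (hdim : Module.finrank F D = 16)
    (θ : D →ₗ[F] D) (hθ : IsOrthogonalInvolution F D θ 4) (a : D) (ha : a ≠ 0) (hs : θ a = a)
    (h7 : HasSeven F (sigmaMap θ a)) :
    ∃ (x : D) (c : F), x ≠ 0 ∧ x * a⁻¹ * θ x = algebraMap F D c := by
  obtain ⟨hinv, hrk⟩ := hθ
  obtain ⟨τ, hτ, hτ1, hτθ⟩ := exists_trace h2 hdim θ hinv
  obtain ⟨E, hsq, hanti, hskew⟩ := h7
  choose c hc hcE using hsq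
  have hK : Module.finrank F (skewElements θ) = 6 := by
    have := finrank_skew h2 θ hinv.2
    rw [hrk, hdim] at this; omega
  have hK' : Module.finrank F (skewElements (thetaP θ a)) = 6 := by
    rw [finrank_skewP θ a ha, hK]
  have hPm : ∀ x y, thetaP θ a (x * y) = thetaP θ a y * thetaP θ a x := fun x y => by
    simp only [thetaP_apply θ hinv a hs, hinv.1, mul_assoc, mul_inv_cancel_left₀ ha]
  have hPi : ∀ x, thetaP θ a (thetaP θ a x) = x := fun x => by
    simp only [thetaP, LinearMap.comp_apply, LinearMap.mulLeft_apply, mul_inv_cancel_left₀ ha,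
      hinv.2, inv_mul_cancel_left₀ ha]
  have hPτ : ∀ x, τ (thetaP θ a x) = τ x := fun x => by
    rw [thetaP_apply θ hinv a hs, hτ, ← mul_assoc, mul_inv_cancel₀ ha, one_mul, hτθ]
  -- the linear parametrization of the seven-dimensional space
  let ι := (Fin 3 ⊕ Fin 3) ⊕ Unit
  let Φ : (ι → F) →ₗ[F] Matrix (Fin 2) (Fin 2) D := Fintype.linearCombination F E
  have hΦ : ∀ v, Φ v = ∑ k, v k • E k := fun v => Fintype.linearCombination_apply F E v
  have hEE : ∀ k l, E k * E l + E l * E k = algebraMap F _ (if k = l then 2 * c k else 0) := by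
    intro k l
    split_ifs with h
    · subst h; rw [hcE, ← map_add, two_mul]
    · rw [hanti k l h]; simp
  have hΦΦ : ∀ v w, Φ v * Φ w + Φ w * Φ v = algebraMap F _ (∑ k, 2 * c k * v k * w k) := by
    intro v w
    have e1 : Φ v * Φ w = ∑ k, ∑ l, (v k * w l) • (E k * E l) := by
      rw [hΦ, hΦ, Finset.sum_mul_sum]
      simp only [smul_mul_smul_comm]
    have e2 : Φ w * Φ v = ∑ k, ∑ l, (v k * w l) • (E l * E k) := by
      rw [hΦ, hΦ, Finset.sum_mul_sum, Finset.sum_comm]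
      simp only [smul_mul_smul_comm, mul_comm (w _)]
    rw [e1, e2, ← Finset.sum_add_distrib, map_sum]
    refine Finset.sum_congr rfl fun k _ => ?_
    rw [← Finset.sum_add_distrib]
    simp only [← smul_add, hEE, Algebra.algebraMap_eq_smul_one, smul_smul]
    rw [← Finset.sum_smul]
    congr 1
    simp; ring
  have hΦinj : ∀ v, Φ v = 0 → v = 0 := by
    intro v hv
    ext k
    have := hΦΦ v (Pi.single k 1)
    rw [hv, zero_mul, mul_zero, add_zero] at this
    have := (algebraMap F (Matrix (Fin 2) (Fin 2) D)).injective (this.symm.trans (map_zero _).symm)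
    simp [Pi.single_apply, h2, hc] at this
    simpa using this
  have hΦs : ∀ v, sigmaMap θ a (Φ v) = - Φ v := by
    intro v
    rw [hΦ, map_sum, ← Finset.sum_neg_distrib]
    exact Finset.sum_congr rfl fun k _ => by rw [map_smul, hskew, smul_neg]
  have h00 : ∀ v, Φ v 0 0 ∈ skewElements θ := fun v => by
    have := congrFun (congrFun (hΦs v) 0) 0
    rw [sigmaMap_apply] at this
    rw [mem_skew]; simpa using this
  have h11 : ∀ v, Φ v 1 1 ∈ skewElements (thetaP θ a) := fun v => by
    have := congrFun (congrFun (hΦs v) 1) 1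
    rw [sigmaMap_apply] at this
    rw [mem_skew, thetaP_apply θ hinv a hs]; simpa using this
  have h10 : ∀ v, Φ v 1 0 = a⁻¹ * θ (Φ v 0 1) := fun v => by
    have := congrFun (congrFun (hΦs v) 1) 0
    rw [sigmaMap_apply] at this
    simpa using this.symm
  let K := skewElements θ
  let K' := skewElements (thetaP θ a)
  let Ψ : (ι → F) →ₗ[F] K × K' :=
    LinearMap.prod ((Matrix.entryLinearMap F D 0 0 ∘ₗ Φ).codRestrict K h00)
      ((Matrix.entryLinearMap F D 1 1 ∘ₗ Φ).codRestrict K' h11)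
  have hΨ1 : ∀ v, ((Ψ v).1 : D) = Φ v 0 0 := fun v => rfl
  have hΨ2 : ∀ v, ((Ψ v).2 : D) = Φ v 1 1 := fun v => rfl
  let B : LinearMap.BilinForm F (K × K') := LinearMap.mk₂ F
    (fun u w => τ ((u.1 : D) * w.1) - τ ((u.2 : D) * w.2))
    (fun u u' w => by simp [add_mul]; ring) (fun r u w => by simp [mul_sub])
    (fun u w w' => by simp [mul_add]; ring) (fun r u w => by simp [mul_sub])
  have hB : ∀ u w, B u w = τ ((u.1 : D) * w.1) - τ ((u.2 : D) * w.2) := fun u w => rfl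
  have hBsymm : ∀ u w, B u w = B w u := fun u w => by
    rw [hB, hB, hτ, hτ (u.2 : D)]
  have hsepl : ∀ u, (∀ w, B u w = 0) → u = 0 := by
    rintro ⟨⟨p, hp⟩, ⟨r, hr⟩⟩ h
    have e1 : p = 0 := by
      refine skew_nondeg h2 θ hinv.1 hinv.2 τ hτ hτ1 hτθ p ((mem_skew _ _).mp hp) fun q hq => ?_
      simpa [hB] using h (⟨q, (mem_skew _ _).mpr hq⟩, 0)
    have e2 : r = 0 := by
      refine skew_nondeg h2 (thetaP θ a) hPm hPi τ hτ hτ1 hPτ r ((mem_skew _ _).mp hr)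
        fun q hq => ?_
      simpa [hB] using h (0, ⟨q, (mem_skew _ _).mpr hq⟩)
    subst e1; subst e2; rfl
  have hnd : B.Nondegenerate :=
    ⟨hsepl, fun u h => hsepl u fun w => by rw [hBsymm]; exact h w⟩
  have hiso : ∀ v w, B (Ψ v) (Ψ w) = 0 := by
    intro v w
    have e := hΦΦ v w
    have e0 := congrArg τ (congrFun (congrFun e 0) 0)
    have e1 := congrArg τ (congrFun (congrFun e 1) 1)
    simp only [Matrix.add_apply, Matrix.mul_apply, Fin.sum_univ_two, Matrix.algebraMap_matrix_apply,
      if_true, map_add] at e0 e1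
    have e2 := e0.trans e1.symm
    rw [hτ (Φ v 1 0), hτ (Φ w 1 0), hτ (Φ w 0 0), hτ (Φ w 1 1)] at e2
    rw [hB, hΨ1, hΨ1, hΨ2, hΨ2]
    have : 2 * (τ (Φ v 0 0 * Φ w 0 0) - τ (Φ v 1 1 * Φ w 1 1)) = 0 := by linear_combination e2
    exact (mul_eq_zero.mp this).resolve_left h2
  have hnotinj : ¬ Function.Injective Ψ := by
    intro hinj
    have r7 : Module.finrank F (LinearMap.range Ψ) = 7 := by
      rw [LinearMap.finrank_range_of_inj hinj]; simp [ι]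
    have hle : LinearMap.range Ψ ≤ B.orthogonal (LinearMap.range Ψ) := by
      rintro _ ⟨v, rfl⟩
      rw [LinearMap.BilinForm.mem_orthogonal_iff]
      rintro _ ⟨w, rfl⟩
      exact hiso w v
    have h1 := Submodule.finrank_mono hle
    rw [LinearMap.BilinForm.finrank_orthogonal hnd, r7, Module.finrank_prod, hK, hK'] at h1
    omega
  rw [← LinearMap.ker_eq_bot, Submodule.eq_bot_iff] at hnotinj
  push Not at hnotinj
  obtain ⟨v, hv, hv0⟩ := hnotinj
  rw [LinearMap.mem_ker] at hv
  have v00 : Φ v 0 0 = 0 := by rw [← hΨ1, hv]; rfl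
  have v11 : Φ v 1 1 = 0 := by rw [← hΨ2, hv]; rfl
  refine ⟨Φ v 0 1, ∑ k, c k * v k * v k, ?_, ?_⟩
  · intro h01
    apply hv0
    apply hΦinj
    ext i j
    fin_cases i <;> fin_cases j
    · exact v00
    · exact h01
    · simp [h10, h01]
    · exact v11
  · have e0 := congrFun (congrFun (hΦΦ v v) 0) 0
    simp only [Matrix.add_apply, Matrix.mul_apply, Fin.sum_univ_two, Matrix.algebraMap_matrix_apply,
      if_true, v00, zero_mul, zero_add, h10, ← mul_assoc] at e0
    have : (2:F) • (Φ v 0 1 * a⁻¹ * θ (Φ v 0 1)) =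
        (2:F) • algebraMap F D (∑ k, c k * v k * v k) := by
      rw [two_smul, e0, Algebra.smul_def, ← map_mul, Finset.mul_sum]
      simp [mul_assoc]
    exact smul_right_injective _ h2 this

end Core

lemma sigmaMap_mul {F D : Type} [Field F] [DivisionRing D] [Algebra F D] (θ : D →ₗ[F] D)
    (hθ : IsInvolution F D θ) (a : D) (ha : a ≠ 0) (X Y : Matrix (Fin 2) (Fin 2) D) :
    sigmaMap θ a (X * Y) = sigmaMap θ a Y * sigmaMap θ a X := by
  have hg : ∀ k : Fin 2, ![1, -a] k * ![1, -a⁻¹] k = 1 := by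
    intro k; fin_cases k <;> simp [ha]
  ext i j
  rw [sigmaMap_apply, Matrix.mul_apply, Matrix.mul_apply, map_sum, Finset.mul_sum, Finset.sum_mul]
  refine Finset.sum_congr rfl fun k _ => ?_
  rw [sigmaMap_apply, sigmaMap_apply, hθ.1]
  calc _ = ![1, -a⁻¹] i * θ (Y k i) * (![1, -a] k * ![1, -a⁻¹] k) * θ (X j k) * ![1, -a] j := by
        rw [hg]; simp only [mul_one, mul_assoc]
    _ = _ := by simp only [mul_assoc]

lemma QPair.map {F H A : Type} [Field F] [Ring H] [Algebra F H] [Ring A] [Algebra F A]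
    {σ' : H →ₗ[F] H} {σ : A →ₗ[F] A} {ε : F} {x y : H} (h : QPair F σ' ε x y) (φ : H →ₐ[F] A)
    (hφ : ∀ x, σ (φ x) = φ (σ' x)) : QPair F σ ε (φ x) (φ y) := by
  obtain ⟨⟨c, hc, hxc⟩, ⟨d, hd, hyd⟩, anti, sx, sy⟩ := h
  refine ⟨⟨c, hc, ?_⟩, ⟨d, hd, ?_⟩, ?_, ?_, ?_⟩
  · rw [← map_mul, hxc, AlgHom.commutes]
  · rw [← map_mul, hyd, AlgHom.commutes]
  · rw [← map_mul, anti, map_neg, map_mul]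
  · rw [hφ, sx, map_smul]
  · rw [hφ, sy, map_smul]

lemma IsInvolution.one {F A : Type} [Field F] [Ring A] [Algebra F A] {σ : A →ₗ[F] A}
    (hσ : IsInvolution F A σ) : σ 1 = 1 := by
  have := hσ.1 1 (σ 1)
  simpa [hσ.2] using this.symm

/-- If the adjoint involution of the hermitian form `⟨1,-a⟩` over a biquaternion division
algebra with orthogonal involution `(D,θ)` is totally decomposable, then `θ` and
`θ' = Int(a⁻¹)∘θ` are conjugate. -/
theorem conjugate_involutions_of_totally_decomposable
    (F : Type) [Field F] (hF : (2:F) ≠ 0)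
    (D : Type) [DivisionRing D] [Algebra F D]
    (hcentral : Algebra.IsCentral F D) (hdim : Module.finrank F D = 16)
    (hbiquat : ∃ (a b a' b' : F), a ≠ 0 ∧ b ≠ 0 ∧ a' ≠ 0 ∧ b' ≠ 0 ∧
      Nonempty (D ≃ₐ[F] (ℍ[F,a,b] ⊗[F] ℍ[F,a',b'])))
    (θ : D →ₗ[F] D) (hθ : IsOrthogonalInvolution F D θ 4)
    (a : D) (ha : a ≠ 0) (hsymm : θ a = a)
    -- σ is the adjoint involution of the hermitian form ⟨1,-a⟩ on M₂(D):
    -- σ(X) = G⁻¹ ⬝ θᵗ(X) ⬝ G with G = diag(1,-a)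
    (htotdec : ∃ (a₁ b₁ a₂ b₂ a₃ b₃ : F), a₁ ≠ 0 ∧ b₁ ≠ 0 ∧ a₂ ≠ 0 ∧ b₂ ≠ 0 ∧ a₃ ≠ 0 ∧ b₃ ≠ 0 ∧
      ∃ (σ₁ : ℍ[F,a₁,b₁] →ₗ[F] ℍ[F,a₁,b₁]) (σ₂ : ℍ[F,a₂,b₂] →ₗ[F] ℍ[F,a₂,b₂])
        (σ₃ : ℍ[F,a₃,b₃] →ₗ[F] ℍ[F,a₃,b₃]),
        IsInvolution F _ σ₁ ∧ IsInvolution F _ σ₂ ∧ IsInvolution F _ σ₃ ∧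
        ∃ f : Matrix (Fin 2) (Fin 2) D ≃ₐ[F] ((ℍ[F,a₁,b₁] ⊗[F] ℍ[F,a₂,b₂]) ⊗[F] ℍ[F,a₃,b₃]),
          ∀ X : Matrix (Fin 2) (Fin 2) D,
            f (Matrix.diagonal ![1, -a⁻¹] * (X.map θ)ᵀ * Matrix.diagonal ![1, -a]) =
              TensorProduct.map (TensorProduct.map σ₁ σ₂) σ₃ (f X)) :
    ∃ u : D, u ≠ 0 ∧ ∀ x : D, a⁻¹ * θ x * a = u * θ (u⁻¹ * x * u) * u⁻¹ := by
  obtain ⟨a₁, b₁, a₂, b₂, a₃, b₃, ha₁, hb₁, ha₂, hb₂, ha₃, hb₃, σ₁, σ₂, σ₃, hσ₁, hσ₂, hσ₃, f, hf⟩ :=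
    htotdec
  have hinv := hθ.1
  have : FiniteDimensional F D := Module.finite_of_finrank_pos (by rw [hdim]; norm_num)
  obtain ⟨ε₁, x₁, y₁, he₁, h₁⟩ := quat_pair hF ha₁ hb₁ σ₁ hσ₁
  obtain ⟨ε₂, x₂, y₂, he₂, h₂⟩ := quat_pair hF ha₂ hb₂ σ₂ hσ₂
  obtain ⟨ε₃, x₃, y₃, he₃, h₃⟩ := quat_pair hF ha₃ hb₃ σ₃ hσ₃
  have t₁ := quat_trace hF σ₁ hσ₁ ε₁ he₁ x₁ y₁ h₁
  have t₂ := quat_trace hF σ₂ hσ₂ ε₂ he₂ x₂ y₂ h₂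
  have t₃ := quat_trace hF σ₃ hσ₃ ε₃ he₃ x₃ y₃ h₃
  have hf' : ∀ X, f (sigmaMap θ a X) = TensorProduct.map (TensorProduct.map σ₁ σ₂) σ₃ (f X) := hf
  have hfs : ∀ Y, sigmaMap θ a (f.symm Y) =
      f.symm (TensorProduct.map (TensorProduct.map σ₁ σ₂) σ₃ Y) := fun Y => by
    rw [AlgEquiv.eq_symm_apply, hf', AlgEquiv.apply_symm_apply]
  -- the trace computation: the number of symplectic factors is even
  have he : ε₁ * ε₂ * ε₃ = 1 := by
    have hconj : f.toLinearEquiv.conj (sigmaMap θ a) =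
        TensorProduct.map (TensorProduct.map σ₁ σ₂) σ₃ := by
      apply LinearMap.ext
      intro Y
      rw [LinearEquiv.conj_apply_apply]
      change f (sigmaMap θ a (f.symm Y)) = _
      rw [hfs, AlgEquiv.apply_symm_apply]
    have e1 := LinearMap.trace_conj' (sigmaMap θ a) f.toLinearEquiv
    rw [hconj, LinearMap.trace_tensorProduct', LinearMap.trace_tensorProduct', t₁, t₂, t₃,
      trace_sigmaMap θ hinv a ha hsymm, trace_theta hF θ hinv.2, hθ.2, hdim] at e1
    norm_num at e1
    have h8 : (8:F) ≠ 0 := by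
      rw [show (8:F) = 2 ^ 3 by norm_num]; exact pow_ne_zero _ hF
    apply mul_left_cancel₀ h8
    linear_combination e1
  let φ₁ : ℍ[F,a₁,b₁] →ₐ[F] Matrix (Fin 2) (Fin 2) D :=
    f.symm.toAlgHom.comp (Algebra.TensorProduct.includeLeft.comp
      Algebra.TensorProduct.includeLeft)
  let φ₂ : ℍ[F,a₂,b₂] →ₐ[F] Matrix (Fin 2) (Fin 2) D :=
    f.symm.toAlgHom.comp (Algebra.TensorProduct.includeLeft.comp
      Algebra.TensorProduct.includeRight)
  let φ₃ : ℍ[F,a₃,b₃] →ₐ[F] Matrix (Fin 2) (Fin 2) D :=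
    f.symm.toAlgHom.comp Algebra.TensorProduct.includeRight
  have e₁ : ∀ x, φ₁ x = f.symm ((x ⊗ₜ 1) ⊗ₜ 1) := fun x => rfl
  have e₂ : ∀ x, φ₂ x = f.symm ((1 ⊗ₜ x) ⊗ₜ 1) := fun x => rfl
  have e₃ : ∀ x, φ₃ x = f.symm (1 ⊗ₜ x) := fun x => rfl
  have q₁ : QPair F (sigmaMap θ a) ε₁ (φ₁ x₁) (φ₁ y₁) := h₁.map φ₁ fun x => by
    rw [e₁, e₁, hfs, TensorProduct.map_tmul, TensorProduct.map_tmul, hσ₂.one, hσ₃.one]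
  have q₂ : QPair F (sigmaMap θ a) ε₂ (φ₂ x₂) (φ₂ y₂) := h₂.map φ₂ fun x => by
    rw [e₂, e₂, hfs, TensorProduct.map_tmul, TensorProduct.map_tmul, hσ₁.one, hσ₃.one]
  have q₃ : QPair F (sigmaMap θ a) ε₃ (φ₃ x₃) (φ₃ y₃) := h₃.map φ₃ fun x => by
    rw [e₃, e₃, hfs, TensorProduct.map_tmul, Algebra.TensorProduct.one_def,
      TensorProduct.map_tmul, hσ₁.one, hσ₂.one]
  have c₁₂ : ∀ x y, Commute (φ₁ x) (φ₂ y) := fun x y => by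
    change φ₁ x * φ₂ y = φ₂ y * φ₁ x
    rw [e₁, e₂, ← map_mul, ← map_mul]; simp
  have c₁₃ : ∀ x y, Commute (φ₁ x) (φ₃ y) := fun x y => by
    change φ₁ x * φ₃ y = φ₃ y * φ₁ x
    rw [e₁, e₃, ← map_mul, ← map_mul]; simp
  have c₂₃ : ∀ x y, Commute (φ₂ x) (φ₃ y) := fun x y => by
    change φ₂ x * φ₃ y = φ₃ y * φ₂ x
    rw [e₂, e₃, ← map_mul, ← map_mul]; simp
  have h7 : HasSeven F (sigmaMap θ a) :=
    hasSeven_of hF (sigmaMap θ a) (sigmaMap_mul θ hinv a ha) he₁ he₂ he₃ he q₁ q₂ q₃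
      ⟨c₁₂ _ _, c₁₂ _ _, c₁₂ _ _, c₁₂ _ _⟩ ⟨c₁₃ _ _, c₁₃ _ _, c₁₃ _ _, c₁₃ _ _⟩
      ⟨c₂₃ _ _, c₂₃ _ _, c₂₃ _ _, c₂₃ _ _⟩
  obtain ⟨x, c, hx, hxc⟩ := core hF hdim θ hθ a ha hsymm h7
  have hθx : θ x * θ x⁻¹ = 1 := by rw [← hinv.1, inv_mul_cancel₀ hx, hinv.one]
  have hθx' : θ x⁻¹ * θ x = 1 := by rw [← hinv.1, mul_inv_cancel₀ hx, hinv.one]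
  have hc : algebraMap F D c ≠ 0 := by
    rw [← hxc]
    exact mul_ne_zero (mul_ne_zero hx (inv_ne_zero ha)) (left_ne_zero_of_mul_eq_one hθx)
  have hainv : a⁻¹ = algebraMap F D c * (x⁻¹ * θ x⁻¹) := by
    have : a⁻¹ = x⁻¹ * (x * a⁻¹ * θ x) * θ x⁻¹ := by
      simp only [mul_assoc, hθx, mul_one, inv_mul_cancel_left₀ hx]
    rw [this, hxc, ← Algebra.commutes, mul_assoc]
  have ha' : a = (algebraMap F D c)⁻¹ * (θ x * x) := by
    apply inv_injective
    rw [hainv]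
    apply eq_inv_of_mul_eq_one_left
    have hcomm0 : Commute (x⁻¹ * θ x⁻¹) (algebraMap F D c) :=
      (Algebra.commutes c (x⁻¹ * θ x⁻¹)).symm
    have hcomm : Commute (x⁻¹ * θ x⁻¹) (algebraMap F D c)⁻¹ := hcomm0.inv_right₀
    calc algebraMap F D c * (x⁻¹ * θ x⁻¹) * ((algebraMap F D c)⁻¹ * (θ x * x))
        = algebraMap F D c * ((x⁻¹ * θ x⁻¹) * (algebraMap F D c)⁻¹) * (θ x * x) := by
          simp only [mul_assoc]
      _ = x⁻¹ * (θ x⁻¹ * θ x) * x := by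
          rw [hcomm.eq, mul_inv_cancel_left₀ hc]; simp only [mul_assoc]
      _ = 1 := by rw [hθx', mul_one, inv_mul_cancel₀ hx]
  refine ⟨x⁻¹, inv_ne_zero hx, fun y => ?_⟩
  rw [inv_inv, hinv.1, hinv.1]
  have hcomm : Commute (algebraMap F D c) (x⁻¹ * θ x⁻¹ * θ y) := Algebra.commutes c _
  calc a⁻¹ * θ y * a = (algebraMap F D c * (x⁻¹ * θ x⁻¹ * θ y)) *
        ((algebraMap F D c)⁻¹ * (θ x * x)) := by rw [hainv, ← ha']; simp only [mul_assoc]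
    _ = (x⁻¹ * θ x⁻¹ * θ y) * (θ x * x) := by
        rw [hcomm.eq, mul_assoc, mul_inv_cancel_left₀ hc]
    _ = _ := by simp only [mul_assoc]
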